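/- Let λ > -1/2, μ > 0, and λ < μ + 1. With C̃_{2n+1}^{(λ,μ)}(t) = ã_{2n+1}^{(λ,μ)} t P_n^{(λ-1/2, μ+1/2)}(2t² - 1), the uniform norm satisfies max_{t ∈ [-1,1]} |C̃_{2n+1}^{(λ,μ)}(t)| ≲ n^μ when μ > λ, and ≲ n^λ when μ ≤ λ, as n → ∞. -/

import Mathlib

open Real Set

/-- Jacobi polynomial `P_n^{(a,b)}` in the standard normalization. -/
noncomputable def jacobiP (a b : ℝ) (n : ℕ) (x : ℝ) : ℝ :=
  (Nat.factorial n : ℝ)⁻¹ *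
    ∑ k ∈ Finset.range (n + 1),
      (Nat.choose n k : ℝ) * (ascPochhammer ℝ k).eval ((n : ℝ) + a + b + 1) *
        (ascPochhammer ℝ (n - k)).eval (a + (k : ℝ) + 1) * ((x - 1) / 2) ^ k

/-- Pochhammer symbol `(q)_n` for real `q`. -/
noncomputable def poch (q : ℝ) (n : ℕ) : ℝ := (ascPochhammer ℝ n).eval q

/-- Normalization constant for odd orthonormal generalized Gegenbauer polynomials. -/
noncomputable def atilde2n1 (l m : ℝ) (n : ℕ) : ℝ :=
  (((2 * n + l + m + 1) * Real.Gamma (n + 1) * Real.Gamma (n + l + m + 1)) /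
    (Real.Gamma (n + l + 1 / 2) * Real.Gamma (n + m + 3 / 2))) ^ ((1 : ℝ) / 2)

/-- The coefficient of `((x - 1) / 2) ^ k` in `n! * jacobiP a b n x`. -/
noncomputable def jacobiCoeff (a b : ℝ) (n k : ℕ) : ℝ :=
  (Nat.choose n k : ℝ) * (ascPochhammer ℝ k).eval ((n : ℝ) + a + b + 1) *
    (ascPochhammer ℝ (n - k)).eval (a + (k : ℝ) + 1)

theorem ascPochhammer_succ_eval_left (x : ℝ) (n : ℕ) :
    (ascPochhammer ℝ (n + 1)).eval x = x * (ascPochhammer ℝ n).eval (x + 1) := by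
  simp [ascPochhammer_succ_left, Polynomial.eval_comp]

theorem jacobiCoeff_succ (a b : ℝ) (n k : ℕ) :
    ((k : ℝ) + 1) * (k + a + 1) * jacobiCoeff a b n (k + 1) =
      ((n : ℝ) - k) * (n + k + a + b + 1) * jacobiCoeff a b n k := by
  unfold jacobiCoeff
  rcases lt_trichotomy k n with h | rfl | h
  · obtain ⟨j, rfl⟩ := Nat.exists_eq_add_of_lt h
    have h1 : k + j + 1 - k = j + 1 := by omega
    have h2 : k + j + 1 - (k + 1) = j := by omega
    have h3 := Nat.choose_succ_right_eq (k + j + 1) k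
    rw [h1] at h3
    have h3' : ((k + j + 1).choose (k + 1) : ℝ) * (k + 1) = (k + j + 1).choose k * (j + 1) := by
      exact_mod_cast h3
    rw [h1, h2, ascPochhammer_succ_eval, ascPochhammer_succ_eval_left]
    push_cast
    rw [show a + (k + 1 : ℝ) + 1 = a + k + 1 + 1 by ring]
    linear_combination (k + a + 1) * (k + j + 1 + a + b + 1 + k) *
      (ascPochhammer ℝ k).eval (k + j + 1 + a + b + 1) *
      (ascPochhammer ℝ j).eval (a + k + 1 + 1) * h3'
  · simp
  · simp [Nat.choose_eq_zero_of_lt h, Nat.choose_eq_zero_of_lt (h.trans (Nat.lt_succ_self k))]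

open Polynomial in
/-- `n! * jacobiP a b n` as a polynomial in `(x - 1) / 2`. -/
noncomputable def jacobiPoly (a b : ℝ) (n : ℕ) : ℝ[X] :=
  ∑ k ∈ Finset.range (n + 1), C (jacobiCoeff a b n k) * X ^ k

theorem jacobiP_eq_eval (a b : ℝ) (n : ℕ) (x : ℝ) :
    jacobiP a b n x = (n.factorial : ℝ)⁻¹ * (jacobiPoly a b n).eval ((x - 1) / 2) := by
  simp [jacobiP, jacobiPoly, Polynomial.eval_finsetSum, jacobiCoeff]

theorem coeff_jacobiPoly (a b : ℝ) (n k : ℕ) :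
    (jacobiPoly a b n).coeff k = jacobiCoeff a b n k := by
  simp only [jacobiPoly, Polynomial.finsetSum_coeff, Polynomial.coeff_C_mul_X_pow]
  rw [Finset.sum_ite_eq]
  split_ifs with h
  · rfl
  · rw [Finset.mem_range, not_lt] at h
    simp [jacobiCoeff, Nat.choose_eq_zero_of_lt h]

open Polynomial in
theorem jacobiPoly_ode (a b : ℝ) (n : ℕ) :
    X * (X * derivative (derivative (jacobiPoly a b n))) +
      X * derivative (derivative (jacobiPoly a b n)) +
      C (a + 1) * derivative (jacobiPoly a b n) +
      C (a + b + 2) * (X * derivative (jacobiPoly a b n)) -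
      C (n * (n + a + b + 1)) * jacobiPoly a b n = 0 := by
  ext k
  have hrec := jacobiCoeff_succ a b n k
  rcases k with _ | _ | k <;>
  simp only [coeff_add, coeff_sub, coeff_C_mul, coeff_X_mul_zero, coeff_X_mul, coeff_derivative,
    coeff_jacobiPoly, coeff_zero] <;> push_cast at hrec ⊢ <;>
  linear_combination hrec

theorem jacobiPoly_eval_zero (a b : ℝ) (n : ℕ) :
    (jacobiPoly a b n).eval 0 = (ascPochhammer ℝ n).eval (a + 1) := by
  rw [← Polynomial.coeff_zero_eq_eval_zero, coeff_jacobiPoly]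
  simp [jacobiCoeff]

theorem ascPochhammer_eval_eq_neg_one_pow_mul (x : ℝ) (n : ℕ) :
    (ascPochhammer ℝ n).eval x = (-1) ^ n * (ascPochhammer ℝ n).eval (-x - n + 1) := by
  have := ascPochhammer_eval_neg_eq_descPochhammer ℝ (-x) n
  rwa [neg_neg, descPochhammer_eval_eq_ascPochhammer] at this

theorem jacobiPoly_eval_neg_one (a b : ℝ) (n : ℕ) :
    (jacobiPoly a b n).eval (-1) = (-1) ^ n * (ascPochhammer ℝ n).eval (b + 1) := by
  have h := Ring.descPochhammer_smeval_add (r := -((n : ℝ) + a + b + 1)) (s := a + n) n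
    (Commute.all _ _)
  simp only [Polynomial.descPochhammer_smeval_eq_ascPochhammer,
    Polynomial.ascPochhammer_smeval_eq_eval] at h
  rw [ascPochhammer_eval_eq_neg_one_pow_mul (b + 1), ← mul_assoc, ← mul_pow]
  rw [show -(b + 1) - (n : ℝ) + 1 = -((n : ℝ) + a + b + 1) + (a + n) - n + 1 by ring, h,
    Finset.Nat.sum_antidiagonal_eq_sum_range_succ_mk]
  simp only [jacobiPoly, Polynomial.eval_finsetSum, mul_neg, mul_one, neg_neg, one_pow, one_mul]
  refine Finset.sum_congr rfl fun k hk => ?_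
  have hk : k ≤ n := Nat.lt_succ_iff.1 (Finset.mem_range.1 hk)
  simp only [Polynomial.eval_mul, Polynomial.eval_C, Polynomial.eval_pow, Polynomial.eval_X,
    jacobiCoeff]
  rw [ascPochhammer_eval_eq_neg_one_pow_mul ((n : ℝ) + a + b + 1), Nat.cast_sub hk,
    show a + (n : ℝ) - (n - k) + 1 = a + k + 1 by ring]
  have : ((-1 : ℝ) ^ k) * (-1) ^ k = 1 := by rw [← mul_pow]; simp
  linear_combination (n.choose k * (ascPochhammer ℝ k).eval (-((n : ℝ) + a + b + 1) - k + 1) *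
    (ascPochhammer ℝ (n - k)).eval (a + k + 1)) * this

/-- Sonin-type monotonicity for the hypergeometric equation. -/
theorem hasDerivAt_sonin {l m M : ℝ} {h h₁ h₂ : ℝ → ℝ}
    (hh : ∀ v, HasDerivAt h (h₁ v) v) (hh₁ : ∀ v, HasDerivAt h₁ (h₂ v) v)
    (ode : ∀ v, v * (1 - v) * h₂ v + (m + 3 / 2 - (l + m + 2) * v) * h₁ v + M * h v = 0) (v : ℝ) :
    HasDerivAt (fun v => M * h v ^ 2 + v * (1 - v) * h₁ v ^ 2)
      (h₁ v ^ 2 * (2 * (l + m + 1) * v - (2 * m + 2))) v := by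
  have hv := hasDerivAt_id' v
  refine ((((hh v).fun_pow 2).const_mul M).fun_add
    ((hv.fun_mul (hv.const_sub 1)).fun_mul ((hh₁ v).fun_pow 2))).congr_deriv ?_
  push_cast
  linear_combination 2 * h₁ v * ode v

theorem hasDerivAt_energy {l m M : ℝ} {h h₁ h₂ : ℝ → ℝ}
    (hh : ∀ v, HasDerivAt h (h₁ v) v) (hh₁ : ∀ v, HasDerivAt h₁ (h₂ v) v)
    (ode : ∀ v, v * (1 - v) * h₂ v + (m + 3 / 2 - (l + m + 2) * v) * h₁ v + M * h v = 0) (v : ℝ) :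
    HasDerivAt (fun v => 2 * v * (M * h v ^ 2 + v * (1 - v) * h₁ v ^ 2) +
        (2 * (1 + m) * (v * (1 - v) * (h v * h₁ v)) +
          (1 + m) * ((m + 1 / 2 - (l + m) * v) * h v ^ 2)))
      (2 * v * h₁ v ^ 2 * ((m + 2 * l) * v - m) - (2 * m * M + (1 + m) * (l + m)) * h v ^ 2) v := by
  have hv := hasDerivAt_id' v
  have h2 := (hv.const_mul 2).fun_mul (hasDerivAt_sonin hh hh₁ ode v)
  have h3 := ((hv.fun_mul (hv.const_sub 1)).fun_mul ((hh v).fun_mul (hh₁ v))).const_mul (2 * (1 + m))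
  have h4 := (((hv.const_mul (l + m)).const_sub (m + 1 / 2)).fun_mul
    ((hh v).fun_pow 2)).const_mul (1 + m)
  refine (h2.fun_add (h3.fun_add h4)).congr_deriv ?_
  push_cast
  linear_combination 2 * (1 + m) * h v * ode v

theorem mul_sonin_le_of_le {l m M v₁ : ℝ} {h h₁ h₂ : ℝ → ℝ}
    (hm : 0 < m) (hM : 0 < M) (hMlm : 0 ≤ 2 * m * M + (1 + m) * (l + m))
    (hv₁ : v₁ ≤ 1) (hv₁m : (m + 2 * |l|) * v₁ ≤ m)
    (hh : ∀ v, HasDerivAt h (h₁ v) v) (hh₁ : ∀ v, HasDerivAt h₁ (h₂ v) v)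
    (ode : ∀ v, v * (1 - v) * h₂ v + (m + 3 / 2 - (l + m + 2) * v) * h₁ v + M * h v = 0)
    {v : ℝ} (hv0 : 0 ≤ v) (hv : v ≤ v₁) :
    v * (M * h v ^ 2 + v * (1 - v) * h₁ v ^ 2) ≤
      3 * ((1 + m) ^ 2 + (1 + m) * (|l| + m + 1)) * h 0 ^ 2 := by
  set K := (1 + m) ^ 2 + (1 + m) * (|l| + m + 1) with hK
  set S : ℝ → ℝ := fun v => M * h v ^ 2 + v * (1 - v) * h₁ v ^ 2 with hS
  set R : ℝ → ℝ := fun v => 2 * (1 + m) * (v * (1 - v) * (h v * h₁ v)) +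
          (1 + m) * ((m + 1 / 2 - (l + m) * v) * h v ^ 2) with hR
  have hl := abs_nonneg l
  have hl1 := le_abs_self l
  have hl2 := neg_abs_le l
  have hKpos : 0 < K := by positivity
  have hS0 : S 0 = M * h 0 ^ 2 := by simp [hS]
  have hSanti : ∀ x, 0 ≤ x → x ≤ v₁ → S x ≤ M * h 0 ^ 2 := by
    intro x hx0 hx
    rw [← hS0]
    refine antitoneOn_of_hasDerivWithinAt_nonpos (convex_Icc 0 v₁)
      (fun x _ => (hasDerivAt_sonin hh hh₁ ode x).continuousAt.continuousWithinAt)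
      (fun x _ => (hasDerivAt_sonin hh hh₁ ode x).hasDerivWithinAt) ?_
      ⟨le_rfl, hx0.trans hx⟩ ⟨hx0, hx⟩ hx0
    intro y hy
    rw [interior_Icc] at hy
    refine mul_nonpos_of_nonneg_of_nonpos (sq_nonneg _) ?_
    nlinarith [hy.1, hy.2, mul_nonneg hl hy.1.le]
  have hEanti : ∀ x y, 0 ≤ x → x ≤ y → y ≤ v₁ → 2 * y * S y + R y ≤ 2 * x * S x + R x := by
    intro x y hx0 hxy hy
    refine antitoneOn_of_hasDerivWithinAt_nonpos (convex_Icc 0 v₁)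
      (fun x _ => (hasDerivAt_energy hh hh₁ ode x).continuousAt.continuousWithinAt)
      (fun x _ => (hasDerivAt_energy hh hh₁ ode x).hasDerivWithinAt) ?_
      ⟨hx0, hxy.trans hy⟩ ⟨hx0.trans hxy, hy⟩ hxy
    intro z hz
    rw [interior_Icc] at hz
    have h1 : (m + 2 * l) * z - m ≤ 0 := by
      nlinarith [hz.1, hz.2]
    have := mul_nonneg (mul_nonneg (by norm_num : (0:ℝ) ≤ 2) hz.1.le) (sq_nonneg (h₁ z))
    nlinarith [mul_nonneg this (neg_nonneg.2 h1), mul_nonneg hMlm (sq_nonneg (h z))]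
  have hRabs : ∀ x, 0 ≤ x → x ≤ v₁ → K ≤ x * M → |R x| ≤ x * S x := by
    intro x hx0 hx hxM
    have hx1 : 0 ≤ 1 - x := by linarith
    have hb : |m + 1 / 2 - (l + m) * x| ≤ |l| + m + 1 := by
      rw [abs_le]
      constructor <;> nlinarith
    have hb' := abs_le.1 hb
    have hh2 := sq_nonneg (h x)
    have t1 := mul_nonneg hx1 (sq_nonneg (x * h₁ x + (1 + m) * h x))
    have t2 := mul_nonneg hx1 (sq_nonneg (x * h₁ x - (1 + m) * h x))
    have t3 := mul_nonneg (sub_nonneg.2 hxM) hh2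
    have t4 := mul_nonneg (mul_nonneg hx0 (sq_nonneg (1 + m))) hh2
    have t5 := mul_nonneg (mul_nonneg (by linarith : 0 ≤ 1 + m) hh2) (sub_nonneg.2 hb'.2)
    have t6 := mul_nonneg (mul_nonneg (by linarith : 0 ≤ 1 + m) hh2) (sub_nonneg.2 hb'.1)
    rw [abs_le]
    simp only [hR, hS]
    rw [hK] at t3
    constructor
    · linarith
    · linarith
  have hsmall : ∀ x, 0 ≤ x → x ≤ v₁ → x * M ≤ K → x * S x ≤ K * h 0 ^ 2 := by
    intro x hx0 hx hxM
    calc x * S x ≤ x * (M * h 0 ^ 2) := mul_le_mul_of_nonneg_left (hSanti x hx0 hx) hx0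
      _ = (x * M) * h 0 ^ 2 := by ring
      _ ≤ _ := mul_le_mul_of_nonneg_right hxM (sq_nonneg _)
  have hKh := mul_nonneg hKpos.le (sq_nonneg (h 0))
  change v * S v ≤ _
  rcases le_total (v * M) K with hvM | hvM
  · linarith [hsmall v hv0 hv hvM]
  · have hc : K / M * M = K := div_mul_cancel₀ _ hM.ne'
    have hc0 : 0 ≤ K / M := by positivity
    have hcv : K / M ≤ v := by rwa [div_le_iff₀ hM]
    have e1 := hEanti _ _ hc0 hcv hv
    have e2 := (abs_le.1 (hRabs v hv0 hv hvM)).1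
    have e3 := (abs_le.1 (hRabs _ hc0 (hcv.trans hv) hc.ge)).2
    have e4 := hsmall _ hc0 (hcv.trans hv) hc.le
    linarith

theorem mul_sq_le_of_ode {l m M : ℝ} {h h₁ h₂ : ℝ → ℝ}
    (hm : 0 < m) (hM : 0 < M) (hMlm : 0 ≤ 2 * m * M + (1 + m) * (l + m))
    (hh : ∀ v, HasDerivAt h (h₁ v) v) (hh₁ : ∀ v, HasDerivAt h₁ (h₂ v) v)
    (ode : ∀ v, v * (1 - v) * h₂ v + (m + 3 / 2 - (l + m + 2) * v) * h₁ v + M * h v = 0)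
    {v : ℝ} (hv0 : 0 ≤ v) (hv1 : v ≤ 1) :
    v * h v ^ 2 ≤ 3 * ((1 + m) ^ 2 + (1 + m) * (|l| + m + 1)) * ((m + 2 * |l|) / m) * h 0 ^ 2 / M +
      h 1 ^ 2 := by
  have hl := abs_nonneg l
  have hl1 := le_abs_self l
  set B := 3 * ((1 + m) ^ 2 + (1 + m) * (|l| + m + 1)) with hB
  set v₁ := m / (m + 2 * |l|) with hv₁
  have hml : 0 < m + 2 * |l| := by positivity
  have hv₁pos : 0 < v₁ := by positivity
  have hv₁m : (m + 2 * |l|) * v₁ = m := mul_div_cancel₀ _ hml.ne'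
  have hv₁1 : v₁ ≤ 1 := (div_le_one hml).2 (by linarith)
  have hinv : (m + 2 * |l|) / m = v₁⁻¹ := (inv_div _ _).symm
  set S : ℝ → ℝ := fun v => M * h v ^ 2 + v * (1 - v) * h₁ v ^ 2 with hS
  have hS1 : S 1 = M * h 1 ^ 2 := by simp [hS]
  have hleS : ∀ x, 0 ≤ x → x ≤ 1 → M * h x ^ 2 ≤ S x := fun x h0 h1 =>
    le_add_of_nonneg_right (mul_nonneg (mul_nonneg h0 (sub_nonneg.2 h1)) (sq_nonneg _))
  have hB0 : 0 ≤ B * h 0 ^ 2 := by positivity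
  have hkey : ∀ x, 0 ≤ x → x ≤ v₁ → x * S x ≤ B * h 0 ^ 2 := fun x h0 h1 =>
    mul_sonin_le_of_le hm hM hMlm hv₁1 hv₁m.le hh hh₁ ode h0 h1
  have hSv₁ : S v₁ ≤ B * h 0 ^ 2 * v₁⁻¹ := by
    rw [← div_eq_mul_inv, le_div_iff₀ hv₁pos, mul_comm]
    exact hkey _ hv₁pos.le le_rfl
  have hM1 : 0 ≤ M * h 1 ^ 2 := by positivity
  have hone : 1 ≤ v₁⁻¹ := (one_le_inv₀ hv₁pos).2 hv₁1
  have hanti : ∀ a b, 0 ≤ a → a ≤ b → b ≤ 1 → (l + m + 1) * b ≤ m + 1 → S b ≤ S a := by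
    intro a b ha hab hb hlb
    refine antitoneOn_of_hasDerivWithinAt_nonpos (convex_Icc a b)
      (fun x _ => (hasDerivAt_sonin hh hh₁ ode x).continuousAt.continuousWithinAt)
      (fun x _ => (hasDerivAt_sonin hh hh₁ ode x).hasDerivWithinAt) ?_
      ⟨le_rfl, hab⟩ ⟨hab, le_rfl⟩ hab
    intro y hy
    rw [interior_Icc] at hy
    refine mul_nonpos_of_nonneg_of_nonpos (sq_nonneg _) ?_
    rcases le_total 0 (l + m + 1) with h | h
    · nlinarith [hy.2]
    · nlinarith [hy.1]
  have hmono : ∀ a, 0 ≤ a → a ≤ 1 → m + 1 ≤ (l + m + 1) * a → S a ≤ S 1 := by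
    intro a ha hb hla
    refine monotoneOn_of_hasDerivWithinAt_nonneg (convex_Icc a 1)
      (fun x _ => (hasDerivAt_sonin hh hh₁ ode x).continuousAt.continuousWithinAt)
      (fun x _ => (hasDerivAt_sonin hh hh₁ ode x).hasDerivWithinAt) ?_
      ⟨le_rfl, hb⟩ ⟨hb, le_rfl⟩ hb
    intro y hy
    rw [interior_Icc] at hy
    refine mul_nonneg (sq_nonneg _) ?_
    have : 0 ≤ l + m + 1 := by
      by_contra! hc
      nlinarith
    nlinarith [hy.1]
  have main : v * S v ≤ B * h 0 ^ 2 * v₁⁻¹ + M * h 1 ^ 2 := by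
    rcases le_total v v₁ with hv | hv
    · nlinarith [hkey v hv0 hv]
    · have hSv : S v ≤ B * h 0 ^ 2 * v₁⁻¹ + M * h 1 ^ 2 := by
        rcases le_total ((l + m + 1) * v) (m + 1) with h' | h'
        · linarith [hanti v₁ v hv₁pos.le hv hv1 h']
        · have := hmono v hv0 hv1 h'
          have : 0 ≤ B * h 0 ^ 2 * v₁⁻¹ := by positivity
          linarith
      have : 0 ≤ S v := le_trans (by positivity) (hleS v hv0 hv1)
      nlinarith
  rw [hinv, ← sub_le_iff_le_add, le_div_iff₀ hM]
  have := mul_le_mul_of_nonneg_left (hleS v hv0 hv1) hv0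
  linarith

theorem ascPochhammer_eval_eq_prod_range_add (x : ℝ) (n : ℕ) :
    (ascPochhammer ℝ n).eval x = ∏ j ∈ Finset.range n, (x + j) := by
  induction n with
  | zero => simp
  | succ n ih => rw [ascPochhammer_succ_eval, ih, Finset.prod_range_succ]

theorem Gamma_nat_add_eq_ascPochhammer {s : ℝ} (hs : 0 < s) (n : ℕ) :
    Gamma (n + s) = (ascPochhammer ℝ n).eval s * Gamma s := by
  induction n with
  | zero => simp
  | succ n ih =>
    rw [ascPochhammer_succ_eval, show ((n + 1 : ℕ) : ℝ) + s = n + s + 1 by push_cast; ring,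
      Gamma_add_one (by positivity), ih]
    ring

open Filter Topology in
theorem exists_Gamma_nat_add_bounds {s : ℝ} (hs : 0 < s) :
    ∃ c C : ℝ, 0 < c ∧ 0 < C ∧ ∀ᶠ n : ℕ in atTop,
      c * ((n : ℝ) ^ (s - 1) * n.factorial) ≤ Gamma (n + s) ∧
      Gamma (n + s) ≤ C * ((n : ℝ) ^ (s - 1) * n.factorial) := by
  have hΓ := Gamma_pos_of_pos hs
  have hlim := GammaSeq_tendsto_Gamma s
  refine ⟨(2 * (1 + s))⁻¹, 2, by positivity, two_pos, ?_⟩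
  filter_upwards [hlim.eventually (lt_mem_nhds (half_lt_self hΓ)),
    hlim.eventually (gt_mem_nhds (show Gamma s < 2 * Gamma s by linarith)),
    eventually_ge_atTop 1] with n h1 h2 hn
  have hn' : (1 : ℝ) ≤ n := by exact_mod_cast hn
  have hn0 : (0 : ℝ) < n := by linarith
  have hΓn : 0 < Gamma (n + s) := Gamma_pos_of_pos (by positivity)
  have hseq : GammaSeq s n = n * (n ^ (s - 1) * n.factorial) * Gamma s /
      ((n + s) * Gamma (n + s)) := by
    have hA : 0 < (ascPochhammer ℝ n).eval s := ascPochhammer_pos n s hs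
    rw [GammaSeq, ← ascPochhammer_eval_eq_prod_range_add, ascPochhammer_succ_eval,
      Gamma_nat_add_eq_ascPochhammer hs, rpow_sub_one hn0.ne']
    field_simp
    ring
  rw [hseq] at h1 h2
  set F := (n : ℝ) ^ (s - 1) * n.factorial with hF
  have hFpos : 0 < F := by positivity
  rw [lt_div_iff₀ (by positivity)] at h1
  rw [div_lt_iff₀ (by positivity)] at h2
  have h1' : (n + s) * Gamma (n + s) < 2 * (n * F) := by
    refine lt_of_mul_lt_mul_left ?_ hΓ.le
    linarith
  have h2' : n * F < 2 * ((n + s) * Gamma (n + s)) := by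
    refine lt_of_mul_lt_mul_left ?_ hΓ.le
    linarith
  constructor
  · rw [inv_mul_le_iff₀ (by positivity)]
    have : n * F ≤ n * (2 * (1 + s) * Gamma (n + s)) := by
      nlinarith [mul_nonneg (mul_nonneg hs.le hΓn.le) (sub_nonneg.2 hn')]
    exact le_of_mul_le_mul_left this hn0
  · have : n * Gamma (n + s) ≤ n * (2 * F) := by nlinarith
    exact le_of_mul_le_mul_left this hn0

open Filter in
theorem exists_ascPochhammer_eval_le {s : ℝ} (hs : 0 < s) :
    ∃ C : ℝ, 0 < C ∧ ∀ᶠ n : ℕ in atTop,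
      (ascPochhammer ℝ n).eval s ≤ C * ((n : ℝ) ^ (s - 1) * n.factorial) := by
  obtain ⟨_, C, _, hC, h⟩ := exists_Gamma_nat_add_bounds hs
  have hΓ := Gamma_pos_of_pos hs
  refine ⟨C / Gamma s, by positivity, ?_⟩
  filter_upwards [h] with n hn
  rw [div_mul_eq_mul_div, le_div_iff₀ hΓ, ← Gamma_nat_add_eq_ascPochhammer hs]
  exact hn.2

open Filter in
theorem exists_atilde2n1_sq_le {l m : ℝ} (hl : -(1 / 2 : ℝ) < l) (hm : 0 < m) :
    ∃ C : ℝ, 0 < C ∧ ∀ᶠ n : ℕ in atTop, atilde2n1 l m n ^ 2 ≤ C * n := by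
  obtain ⟨_, C₁, _, hC₁, h₁⟩ := exists_Gamma_nat_add_bounds (show 0 < l + m + 1 by linarith)
  obtain ⟨c₂, _, hc₂, _, h₂⟩ := exists_Gamma_nat_add_bounds (show 0 < l + 1 / 2 by linarith)
  obtain ⟨c₃, _, hc₃, _, h₃⟩ := exists_Gamma_nat_add_bounds (show 0 < m + 3 / 2 by linarith)
  have hlm : 0 < l + m + 1 := by linarith
  refine ⟨(2 + (l + m + 1)) * (C₁ / (c₂ * c₃)), by positivity, ?_⟩
  filter_upwards [h₁, h₂, h₃, eventually_ge_atTop 1] with n ⟨_, h₁⟩ ⟨h₂, _⟩ ⟨h₃, _⟩ hn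
  have hn' : (1 : ℝ) ≤ n := by exact_mod_cast hn
  have hn0 : (0 : ℝ) < n := by linarith
  rw [show (n : ℝ) + (l + m + 1) = n + l + m + 1 by ring] at h₁
  rw [show (n : ℝ) + (l + 1 / 2) = n + l + 1 / 2 by ring] at h₂
  rw [show (n : ℝ) + (m + 3 / 2) = n + m + 3 / 2 by ring] at h₃
  have hq : (0 : ℝ) < n.factorial := by exact_mod_cast n.factorial_pos
  have g₁ : 0 < Gamma ((n : ℝ) + l + m + 1) := Gamma_pos_of_pos (by linarith)
  have g₂ : 0 < Gamma ((n : ℝ) + l + 1 / 2) := Gamma_pos_of_pos (by linarith)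
  have g₃ : 0 < Gamma ((n : ℝ) + m + 3 / 2) := Gamma_pos_of_pos (by linarith)
  have hlin : 0 ≤ 2 * (n : ℝ) + l + m + 1 := by linarith
  have hpow : (n : ℝ) ^ (l + m + 1 - 1) =
      (n : ℝ) ^ (l + 1 / 2 - 1) * (n : ℝ) ^ (m + 3 / 2 - 1) := by
    rw [← rpow_add hn0]; ring_nf
  have hratio : (n.factorial : ℝ) * Gamma (n + l + m + 1) /
      (Gamma (n + l + 1 / 2) * Gamma (n + m + 3 / 2)) ≤ C₁ / (c₂ * c₃) := by
    rw [div_le_div_iff₀ (by positivity) (by positivity)]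
    have t₁ := mul_le_mul h₂ h₃ (by positivity) g₂.le
    have t₂ := mul_le_mul_of_nonneg_right h₁ (show 0 ≤ n.factorial * (c₂ * c₃) by positivity)
    rw [hpow] at t₂
    linarith [mul_le_mul_of_nonneg_left t₁ hC₁.le]
  rw [atilde2n1, ← sqrt_eq_rpow, Real.Gamma_nat_eq_factorial, sq_sqrt (by positivity),
    mul_assoc, mul_div_assoc]
  calc _ ≤ ((2 + (l + m + 1)) * n) * (C₁ / (c₂ * c₃)) := by
        refine mul_le_mul ?_ hratio (by positivity) (by positivity)
        nlinarith
    _ = _ := by ring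

theorem mul_jacobiPoly_eval_sq_le {l m : ℝ} (hl : -(1 / 2 : ℝ) < l) (hm : 0 < m) :
    ∃ C : ℝ, 0 < C ∧ ∀ n : ℕ, (1 + m) / m ≤ n → ∀ v : ℝ, 0 ≤ v → v ≤ 1 →
      v * (jacobiPoly (l - 1 / 2) (m + 1 / 2) n).eval (v - 1) ^ 2 ≤
        C * (ascPochhammer ℝ n).eval (m + 3 / 2) ^ 2 / n ^ 2 +
          (ascPochhammer ℝ n).eval (l + 1 / 2) ^ 2 := by
  refine ⟨3 * ((1 + m) ^ 2 + (1 + m) * (|l| + m + 1)) * ((m + 2 * |l|) / m), by positivity, ?_⟩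
  intro n hn v hv0 hv1
  set J := jacobiPoly (l - 1 / 2) (m + 1 / 2) n with hJ
  have hn1 : (1 : ℝ) < n := lt_of_lt_of_le ((one_lt_div hm).2 (by linarith)) hn
  have hmn : 1 + m ≤ m * n := by rwa [div_le_iff₀ hm, mul_comm] at hn
  have hMn : (n : ℝ) ^ 2 ≤ n * (n + l + m + 1) := by nlinarith
  have hM : (0 : ℝ) < n * (n + l + m + 1) := lt_of_lt_of_le (by positivity) hMn
  have hMlm : 0 ≤ 2 * m * (n * (n + l + m + 1)) + (1 + m) * (l + m) := by nlinarith
  have hd (p : Polynomial ℝ) (v : ℝ) :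
      HasDerivAt (fun v => p.eval (v - 1)) (p.derivative.eval (v - 1)) v := by
    exact (p.hasDerivAt (v - 1)).comp_sub_const v 1
  have ode (v : ℝ) : v * (1 - v) * J.derivative.derivative.eval (v - 1) +
      (m + 3 / 2 - (l + m + 2) * v) * J.derivative.eval (v - 1) +
      n * (n + l + m + 1) * J.eval (v - 1) = 0 := by
    have := congrArg (Polynomial.eval (v - 1)) (jacobiPoly_ode (l - 1 / 2) (m + 1 / 2) n)
    simp only [Polynomial.eval_add, Polynomial.eval_sub, Polynomial.eval_mul, Polynomial.eval_X,
      Polynomial.eval_C, Polynomial.eval_zero, ← hJ] at this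
    linear_combination -this
  have h := mul_sq_le_of_ode hm hM hMlm (hd J) (hd J.derivative) ode hv0 hv1
  have h0 : J.eval (0 - 1) ^ 2 = (ascPochhammer ℝ n).eval (m + 3 / 2) ^ 2 := by
    rw [zero_sub, jacobiPoly_eval_neg_one, mul_pow, ← pow_mul, mul_comm n, pow_mul]
    norm_num
    ring_nf
  have h1 : J.eval (1 - 1) = (ascPochhammer ℝ n).eval (l + 1 / 2) := by
    rw [sub_self, jacobiPoly_eval_zero]
    ring_nf
  rw [h0, h1] at h
  refine h.trans ?_
  gcongr

theorem odd_gegenbauer_max_upper_bound (l m : ℝ) (hl : -(1 / 2 : ℝ) < l) (hm : 0 < m)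
    (hlm : l < m + 1) :
    ∃ C : ℝ, 0 < C ∧ ∃ n₀ : ℕ, ∀ n : ℕ, n₀ ≤ n →
      sSup ((fun t : ℝ =>
          |atilde2n1 l m n * t * jacobiP (l - 1 / 2) (m + 1 / 2) n (2 * t ^ 2 - 1)|) ''
        Set.Icc (-1) 1) ≤
      if l < m then C * (n : ℝ) ^ m else C * (n : ℝ) ^ l := by
  obtain ⟨A, hA, hatilde⟩ := exists_atilde2n1_sq_le hl hm
  obtain ⟨B, hB, hpoly⟩ := mul_jacobiPoly_eval_sq_le hl hm
  obtain ⟨C₁, hC₁, hleft⟩ := exists_ascPochhammer_eval_le (show 0 < m + 3 / 2 by linarith)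
  obtain ⟨C₂, hC₂, hright⟩ := exists_ascPochhammer_eval_le (show 0 < l + 1 / 2 by linarith)
  obtain ⟨n₀, hn₀⟩ := Filter.eventually_atTop.1 (hatilde.and (hleft.and hright))
  set D := A * (B * C₁ ^ 2 + C₂ ^ 2) with hD
  have hDpos : 0 < D := by positivity
  refine ⟨√D, sqrt_pos.2 hDpos, max n₀ (max 1 ⌈(1 + m) / m⌉₊), fun n hn => ?_⟩
  obtain ⟨ha, hb, hc⟩ := hn₀ n (le_of_max_le_left hn)
  have hn1 : (1 : ℝ) ≤ n := by exact_mod_cast (le_of_max_le_left (le_of_max_le_right hn))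
  have hnm : (1 + m) / m ≤ n :=
    Nat.ceil_le.1 (le_of_max_le_right (le_of_max_le_right hn))
  have hn0 : (0 : ℝ) < n := by linarith
  have hq : (0 : ℝ) < n.factorial := by exact_mod_cast n.factorial_pos
  suffices key : ∀ r : ℝ, l ≤ r → m ≤ r → sSup ((fun t : ℝ =>
          |atilde2n1 l m n * t * jacobiP (l - 1 / 2) (m + 1 / 2) n (2 * t ^ 2 - 1)|) ''
        Set.Icc (-1) 1) ≤ √D * (n : ℝ) ^ r by
    split_ifs with h
    · exact key m h.le le_rfl
    · exact key l le_rfl (not_lt.1 h)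
  intro r hlr hmr
  refine Real.sSup_le ?_ (by positivity)
  rintro _ ⟨t, ht, rfl⟩
  have ht2 : t ^ 2 ≤ 1 := by nlinarith [ht.1, ht.2]
  have hP := hpoly n hnm (t ^ 2) (sq_nonneg t) ht2
  have hhalf : ((n : ℝ) ^ (1 / 2 : ℝ)) ^ 2 = n := by
    rw [← sqrt_eq_rpow, sq_sqrt hn0.le]
  have hpm : ((n : ℝ) ^ (m + 3 / 2 - 1)) ^ 2 = ((n : ℝ) ^ m) ^ 2 * n := by
    rw [show m + 3 / 2 - 1 = m + 1 / 2 by ring, rpow_add hn0, mul_pow, hhalf]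
  have hpl : ((n : ℝ) ^ (l + 1 / 2 - 1)) ^ 2 = ((n : ℝ) ^ l) ^ 2 / n := by
    rw [show l + 1 / 2 - 1 = l - 1 / 2 by ring, rpow_sub hn0, div_pow, hhalf]
  have hb2 : (ascPochhammer ℝ n).eval (m + 3 / 2) ^ 2 ≤
      C₁ ^ 2 * (((n : ℝ) ^ r) ^ 2 * n * n.factorial ^ 2) := by
    refine (pow_le_pow_left₀ (ascPochhammer_pos n _ (by linarith)).le hb 2).trans ?_
    rw [mul_pow, mul_pow, hpm]
    gcongr
  have hc2 : (ascPochhammer ℝ n).eval (l + 1 / 2) ^ 2 ≤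
      C₂ ^ 2 * (((n : ℝ) ^ r) ^ 2 / n * n.factorial ^ 2) := by
    refine (pow_le_pow_left₀ (ascPochhammer_pos n _ (by linarith)).le hc 2).trans ?_
    rw [mul_pow, mul_pow, hpl]
    gcongr
  refine abs_le_of_sq_le_sq ?_ (by positivity)
  rw [jacobiP_eq_eval, show (2 * t ^ 2 - 1 - 1) / 2 = t ^ 2 - 1 by ring, mul_pow (√D),
    sq_sqrt hDpos.le]
  calc _ = atilde2n1 l m n ^ 2 * ((n.factorial : ℝ)⁻¹ ^ 2 *
        (t ^ 2 * (jacobiPoly (l - 1 / 2) (m + 1 / 2) n).eval (t ^ 2 - 1) ^ 2)) := by ring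
    _ ≤ (A * n) * ((n.factorial : ℝ)⁻¹ ^ 2 *
        (B * (C₁ ^ 2 * (((n : ℝ) ^ r) ^ 2 * n * n.factorial ^ 2)) / n ^ 2 +
          C₂ ^ 2 * (((n : ℝ) ^ r) ^ 2 / n * n.factorial ^ 2))) := by
      refine mul_le_mul ha ?_ (by positivity) (by positivity)
      refine mul_le_mul_of_nonneg_left (hP.trans ?_) (by positivity)
      gcongr
    _ = D * ((n : ℝ) ^ r) ^ 2 := by
      rw [hD]
      field_simp
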